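/- arXiv:math/0606004 — 2 statements merged into one kernel-verified Lean document; each statement's English description precedes it below -/
import Mathlib

section
/- Every weak parallelepiped structure on a nonempty set is the inverse image of a strong parallelepiped structure: if (𝒫,𝒬) is a weak parallelepiped structure on a nonempty set X, then there exist a set Y, a surjection r: X → Y, and a strong parallelepiped structure (𝒫_Y,𝒬_Y) on Y such that 𝒫 = (r^{[2]})⁻¹(𝒫_Y) and 𝒬 = (r^{[3]})⁻¹(𝒬_Y), where r^{[2]}: X⁴ → Y⁴ and r^{[3]}: X⁸ → Y⁸ apply r coordinatewise. -/
open scoped Pointwise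

namespace HK

/-- Quadruples of elements of `X`, indexed by the vertices `00, 01, 10, 11` of the square. -/
abbrev Quad (X : Type) := X × X × X × X

/-- Vertices of the cube `{0,1}³`. -/
abbrev Vtx := Fin 3 → Bool

/-- Elements of `X^{[3]} = X⁸`, indexed by the vertices of the cube. -/
abbrev Cube (X : Type) := Vtx → X

variable {X Y : Type}

/-- Apply a map coordinatewise to a quadruple. -/
def map4 (f : X → Y) (p : Quad X) : Quad Y := (f p.1, f p.2.1, f p.2.2.1, f p.2.2.2)

/-- Apply a map coordinatewise to a cube. -/
def mapCube (f : X → Y) (x : Cube X) : Cube Y := fun v => f (x v)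

/-- A weak parallelogram structure: the relation `(x00,x01) ∼ (x10,x11) ↔ (x00,x01,x10,x11) ∈ P`
is an equivalence relation, `P` is invariant under exchanging the two middle entries, and
any three points can be completed to a parallelogram. -/
def IsWeakParallelogram (P : Set (Quad X)) : Prop :=
  (∀ a b : X, (a, b, a, b) ∈ P) ∧
  (∀ a b c d : X, (a, b, c, d) ∈ P → (c, d, a, b) ∈ P) ∧
  (∀ a b c d e f : X, (a, b, c, d) ∈ P → (c, d, e, f) ∈ P → (a, b, e, f) ∈ P) ∧
  (∀ a b c d : X, (a, b, c, d) ∈ P → (a, c, b, d) ∈ P) ∧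
  (∀ a b c : X, ∃ d, (a, b, c, d) ∈ P)

/-- A strong parallelogram structure: the completing fourth point is unique. -/
def IsStrongParallelogram (P : Set (Quad X)) : Prop :=
  IsWeakParallelogram P ∧ ∀ a b c : X, ∃! d, (a, b, c, d) ∈ P

/-- The entry of a quadruple at a vertex of the square. -/
def quadAt (p : Quad X) : Bool → Bool → X
  | false, false => p.1
  | false, true => p.2.1
  | true, false => p.2.2.1
  | true, true => p.2.2.2

/-- The cube whose face `ε₁ = 0` is `p` and whose face `ε₁ = 1` is `q`. -/
def joinQuad (p q : Quad X) : Cube X :=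
  fun v => if v 0 = false then quadAt p (v 1) (v 2) else quadAt q (v 1) (v 2)

/-- The vertex of the cube with value `b` at coordinate `i` and values `u,v` at the two
remaining coordinates, taken in increasing order. -/
def insert3 (i : Fin 3) (b u v : Bool) : Vtx :=
  if i = 0 then ![b, u, v] else if i = 1 then ![u, b, v] else ![u, v, b]

/-- The face `{v : v i = b}` of a cube, as a quadruple in lexicographic order. -/
def face (x : Cube X) (i : Fin 3) (b : Bool) : Quad X :=
  (x (insert3 i b false false), x (insert3 i b false true),
   x (insert3 i b true false), x (insert3 i b true true))

/-- The permutations of the vertices of the cube induced by Euclidean isometries of the unit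
cube: a permutation of the three coordinates composed with flips of some coordinates. -/
def cubeSym (σ : Equiv.Perm (Fin 3)) (c : Vtx) (v : Vtx) : Vtx :=
  fun j => xor (v (σ j)) (c j)

/-- A weak parallelepiped structure `(P, Q)`: every face of an element of `Q` lies in `P`;
`Q` is invariant under the Euclidean permutations of the cube; the relation `≈` on `P`
(`p ≈ q ↔ joinQuad p q ∈ Q`) is an equivalence relation; and seven points whose three
determined faces lie in `P` can be completed to an element of `Q`. -/
def IsWeakParallelepiped (P : Set (Quad X)) (Q : Set (Cube X)) : Prop :=
  IsWeakParallelogram P ∧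
  (∀ x ∈ Q, ∀ (i : Fin 3) (b : Bool), face x i b ∈ P) ∧
  (∀ (σ : Equiv.Perm (Fin 3)) (c : Vtx), ∀ x ∈ Q, (fun v => x (cubeSym σ c v)) ∈ Q) ∧
  (∀ p ∈ P, joinQuad p p ∈ Q) ∧
  (∀ p q : Quad X, joinQuad p q ∈ Q → joinQuad q p ∈ Q) ∧
  (∀ p q r : Quad X, joinQuad p q ∈ Q → joinQuad q r ∈ Q → joinQuad p r ∈ Q) ∧
  (∀ x000 x001 x010 x011 x100 x101 x110 : X,
    (x000, x001, x010, x011) ∈ P → (x000, x010, x100, x110) ∈ P →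
    (x000, x001, x100, x101) ∈ P →
    ∃ x111, joinQuad (x000, x001, x010, x011) (x100, x101, x110, x111) ∈ Q)

/-- A strong parallelepiped structure: the completing eighth point is unique. -/
def IsStrongParallelepiped (P : Set (Quad X)) (Q : Set (Cube X)) : Prop :=
  IsWeakParallelepiped P Q ∧
  ∀ x000 x001 x010 x011 x100 x101 x110 : X,
    (x000, x001, x010, x011) ∈ P → (x000, x010, x100, x110) ∈ P →
    (x000, x001, x100, x101) ∈ P →
    ∃! x111, joinQuad (x000, x001, x010, x011) (x100, x101, x110, x111) ∈ Q

/-- The setoid on `X²` given by the parallelogram relation `∼`. -/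
def baseSetoid (P : Set (Quad X)) (hP : IsWeakParallelogram P) : Setoid (X × X) where
  r p q := (p.1, p.2, q.1, q.2) ∈ P
  iseqv := ⟨fun p => hP.1 p.1 p.2,
            fun h => hP.2.1 _ _ _ _ h,
            fun h h' => hP.2.2.1 _ _ _ _ _ _ h h'⟩

/-- The base `B = X²/∼` of a weak parallelogram structure. -/
def Base (P : Set (Quad X)) (hP : IsWeakParallelogram P) : Type := Quotient (baseSetoid P hP)

/-- The class `⟨x,y⟩ ∈ B` of a pair `(x,y)`. -/
def cls (P : Set (Quad X)) (hP : IsWeakParallelogram P) (x y : X) : Base P hP :=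
  Quotient.mk (baseSetoid P hP) (x, y)

/-- The Gowers-type sum over parallelograms attached to a finitely supported `f : X → ℂ`. -/
noncomputable def gSum2 (P : Set (Quad X)) (f : X →₀ ℂ) : ℂ :=
  ∑ᶠ q ∈ P, f q.1 * (starRingEnd ℂ) (f q.2.1) * (starRingEnd ℂ) (f q.2.2.1) * f q.2.2.2

/-- The seminorm `‖f‖_P = (gSum2 P f)^{1/4}`. -/
noncomputable def pNorm (P : Set (Quad X)) (f : X →₀ ℂ) : ℝ :=
  (gSum2 P f).re ^ ((1 : ℝ) / 4)

/-- `C^{|ε|} z`: conjugate `z` when the vertex `v` has an odd number of `1` entries. -/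
noncomputable def cConjFactor (v : Vtx) (z : ℂ) : ℂ :=
  if xor (v 0) (xor (v 1) (v 2)) then (starRingEnd ℂ) z else z

/-- The Gowers-type sum over parallelepipeds attached to a finitely supported `f : X → ℂ`. -/
noncomputable def gSum3 (Q : Set (Cube X)) (f : X →₀ ℂ) : ℂ :=
  ∑ᶠ x ∈ Q, ∏ v : Vtx, cConjFactor v (f (x v))

/-- The seminorm `‖f‖_Q = (gSum3 Q f)^{1/8}`. -/
noncomputable def qNorm (Q : Set (Cube X)) (f : X →₀ ℂ) : ℝ :=
  (gSum3 Q f).re ^ ((1 : ℝ) / 8)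

/-- The structure group of a parallelepiped structure, as a set of bijections of `X`:
those `g` mapping every parallelogram to an equivalent parallelogram. -/
def structSet (P : Set (Quad X)) (Q : Set (Cube X)) : Set (Equiv.Perm X) :=
  {g | ∀ p ∈ P, map4 g p ∈ P ∧ joinQuad (map4 g p) p ∈ Q}

/-- `x` and `y` lie in the same fiber of `π : X → B`, `π(x) = ⟨i,x⟩`. -/
def sameFiber (P : Set (Quad X)) (i x y : X) : Prop := (i, x, i, y) ∈ P

/-- A vertical quadruple: all four points lie in one fiber. -/
def VerticalQ (P : Set (Quad X)) (i : X) (w : Quad X) : Prop :=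
  sameFiber P i w.1 w.2.1 ∧ sameFiber P i w.2.1 w.2.2.1 ∧ sameFiber P i w.2.2.1 w.2.2.2

/-- `y = u·x` where `u = [w]` is the class of the vertical parallelogram `w`:
`(x,x,x,y)` is a parallelogram equivalent to `w`. -/
def actsRel (P : Set (Quad X)) (Q : Set (Cube X)) (w : Quad X) (x y : X) : Prop :=
  (x, x, x, y) ∈ P ∧ joinQuad (x, x, x, y) w ∈ Q

section Groups

variable (G : Type) [Group G]

/-- The diagonal embedding `G → G^{[2]}`. -/
def diagHom2 : G →* Quad G where
  toFun g := (g, g, g, g)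
  map_one' := rfl
  map_mul' _ _ := rfl

/-- The diagonal embedding `G → G^{[3]}`. -/
def diagHom3 : G →* Cube G where
  toFun g := fun _ => g
  map_one' := rfl
  map_mul' _ _ := rfl

/-- The two dimensional edge group `G^{[2,1]}`. -/
def edgeGroup2 : Subgroup (Quad G) :=
  Subgroup.closure
    {q : Quad G | ∃ g : G, q = (g, g, 1, 1) ∨ q = (g, 1, g, 1) ∨ q = (g, g, g, g)}

/-- The second commutator subgroup `G₃ = [G, G₂]`. -/
def secondCommutator : Subgroup G := ⁅(⊤ : Subgroup G), commutator G⁆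

variable {G}

/-- The edge group `F^{[2,1]}` of a subgroup `F ≤ G`, inside `G^{[2]}`. -/
def edgeGroup2Of (F : Subgroup G) : Subgroup (Quad G) :=
  Subgroup.closure
    {q : Quad G | ∃ u ∈ F, q = (u, u, 1, 1) ∨ q = (u, 1, u, 1) ∨ q = (u, u, u, u)}

/-- `F^{[2]} = F⁴` as a subgroup of `G^{[2]}`. -/
def quadSub (F : Subgroup G) : Subgroup (Quad G) := F.prod (F.prod (F.prod F))

/-- Faces of the cube `{0,1}³`. -/
def IsFace3 (α : Set Vtx) : Prop := ∃ (i : Fin 3) (b : Bool), α = {v : Vtx | v i = b}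

/-- Edges of the cube `{0,1}³`. -/
def IsEdge3 (α : Set Vtx) : Prop :=
  ∃ (i j : Fin 3) (b c : Bool), i ≠ j ∧ α = {v : Vtx | v i = b ∧ v j = c}

open Classical in
/-- The element `g^{[3,α]}` of `G^{[3]}`, with coordinate `g` on `α` and `1` elsewhere. -/
noncomputable def cubeElt (α : Set Vtx) (g : G) : Cube G :=
  fun v => if v ∈ α then g else 1

variable (G)

/-- The face group `G^{[3,2]}`, generated by the `g^{[3,f]}` for faces `f` of the cube. -/
noncomputable def faceGroup : Subgroup (Cube G) :=
  Subgroup.closure {x : Cube G | ∃ (g : G) (α : Set Vtx), IsFace3 α ∧ x = cubeElt α g}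

variable {G}

/-- The edge group `F^{[3,1]}` of a subgroup `F ≤ G`, generated by the `u^{[3,e]}` for
`u ∈ F` and edges `e` of the cube. -/
noncomputable def edgeGroup3 (F : Subgroup G) : Subgroup (Cube G) :=
  Subgroup.closure {x : Cube G | ∃ u ∈ F, ∃ α : Set Vtx, IsEdge3 α ∧ x = cubeElt α u}

end Groups

/-- The data realizing `(PY, QY)` as the nilparallelepiped structure associated to
`G`, `F`, `Γ` via the coset projection `p : G → Y ≅ G/Γ`. -/
def NilWitness (G : Type) [Group G] (F Γ : Subgroup G) {Y : Type} (p : G → Y)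
    (PY : Set (Quad Y)) (QY : Set (Cube Y)) : Prop :=
  commutator G ≤ F ∧ F ≤ Subgroup.center G ∧ Γ ⊓ F = ⊥ ∧
  Function.Surjective p ∧ (∀ g g' : G, p g = p g' ↔ g⁻¹ * g' ∈ Γ) ∧
  PY = map4 p '' ((edgeGroup2 G : Set (Quad G)) * (quadSub F : Set (Quad G))) ∧
  QY = mapCube p '' ((faceGroup G : Set (Cube G)) * (edgeGroup3 F : Set (Cube G)))

/-- `(PY, QY)` is a nilparallelepiped structure. -/
def IsNilStructure {Y : Type} (PY : Set (Quad Y)) (QY : Set (Cube Y)) : Prop :=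
  ∃ (G : Type) (inst : Group G) (F Γ : @Subgroup G inst) (p : G → Y),
    @NilWitness G inst F Γ Y p PY QY

/-- A splitting of the exact sequence `0 → F → P_s → B → 0` for `s = ⟨a₀, b₀⟩`, encoded
by a lift `ψ : X → 𝒫_s` of a homomorphism section `φ : B → P_s` of `q_s`:
`ψ x` is a parallelogram in `𝒫_s` representing the class `φ(π(x))`. -/
def IsSplittingAt (P : Set (Quad X)) (Q : Set (Cube X)) (i a₀ b₀ : X) : Prop :=
  ∃ ψ : X → Quad X,
    (∀ x, ψ x ∈ P) ∧
    (∀ x, (a₀, b₀, (ψ x).1, (ψ x).2.1) ∈ P) ∧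
    (∀ x, ((ψ x).1, (ψ x).2.2.1, i, x) ∈ P) ∧
    (∀ x y, (i, x, i, y) ∈ P → joinQuad (ψ x) (ψ y) ∈ Q) ∧
    (∀ x1 x2 x3, (x1, x3, i, x2) ∈ P →
      ∃ c d, joinQuad ((ψ x1).2.2.1, (ψ x1).2.2.2, c, d) (ψ x2) ∈ Q ∧
        joinQuad ((ψ x1).1, (ψ x1).2.1, c, d) (ψ x3) ∈ Q)

/-- `(B, c)` is a realization of the base group of the parallelogram structure `P`,
`c x y` realizing the class `⟨x,y⟩`. -/
def IsBaseRealization (P : Set (Quad X)) (B : Type) [AddCommGroup B] (c : X → X → B) : Prop :=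
  (Function.Surjective fun p : X × X => c p.1 p.2) ∧
  (∀ a b a' b' : X, c a b = c a' b' ↔ (a, b, a', b') ∈ P) ∧
  (∀ a b d : X, c a b + c b d = c a d)

/-- `(F, fl)` is a realization of the fiber group of the parallelepiped structure `(P, Q)`:
`fl` maps vertical parallelograms onto `F`, separates exactly the `≈`-classes, and is
additive with respect to the composition of vertical parallelograms. -/
def IsFiberRealization (P : Set (Quad X)) (Q : Set (Cube X)) (i : X) (F : Type)
    [AddCommGroup F] (fl : Quad X → F) : Prop :=
  (∀ u : F, ∃ w, VerticalQ P i w ∧ fl w = u) ∧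
  (∀ w w' : Quad X, VerticalQ P i w → VerticalQ P i w' →
    (fl w = fl w' ↔ joinQuad w w' ∈ Q)) ∧
  (∀ x0 x1 x2 x3 x4 x5 : X, sameFiber P i x0 x1 → sameFiber P i x1 x2 →
    sameFiber P i x2 x3 → sameFiber P i x3 x4 → sameFiber P i x4 x5 →
    fl (x0, x1, x2, x3) + fl (x2, x3, x4, x5) = fl (x0, x1, x4, x5))

/-- A divisible (equivalently, injective) abelian group. -/
def IsDivisibleGroup (F : Type) [AddCommGroup F] : Prop :=
  ∀ (u : F) (n : ℕ), 0 < n → ∃ v : F, n • v = u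

/-- A projective abelian group (projective as a `ℤ`-module). -/
def IsProjectiveAdd (B : Type) [AddCommGroup B] : Prop := Module.Projective ℤ B


theorem mapCube_joinQuad (f : X → Y) (p q : Quad X) :
    mapCube f (joinQuad p q) = joinQuad (map4 f p) (map4 f q) := by
  funext v
  unfold mapCube joinQuad map4
  cases v 0 <;> cases v 1 <;> cases v 2 <;> rfl

theorem joinQuad_face (x : Cube X) : joinQuad (face x 0 false) (face x 0 true) = x := by
  funext v
  have hv : v = ![v 0, v 1, v 2] := by
    funext i
    fin_cases i <;> rfl
  rw [hv]
  cases v 0 <;> cases v 1 <;> cases v 2 <;> rfl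

/-- `y` can replace `x` at one vertex of the constant cube `x`. -/
def CubeEquiv (Q : Set (Cube X)) (x y : X) : Prop :=
  joinQuad (x, x, x, x) (x, x, x, y) ∈ Q

namespace IsWeakParallelepiped

variable {P : Set (Quad X)} {Q : Set (Cube X)}

theorem joinQuad_symm (h : IsWeakParallelepiped P Q) {p q : Quad X} (hpq : joinQuad p q ∈ Q) :
    joinQuad q p ∈ Q :=
  h.2.2.2.2.1 p q hpq

theorem joinQuad_trans (h : IsWeakParallelepiped P Q) {p q r : Quad X}
    (hpq : joinQuad p q ∈ Q) (hqr : joinQuad q r ∈ Q) : joinQuad p r ∈ Q :=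
  h.2.2.2.2.2.1 p q r hpq hqr

theorem joinQuad_congr_left (h : IsWeakParallelepiped P Q) {p q r : Quad X}
    (hpq : joinQuad p q ∈ Q) : joinQuad p r ∈ Q ↔ joinQuad q r ∈ Q :=
  ⟨h.joinQuad_trans (h.joinQuad_symm hpq), h.joinQuad_trans hpq⟩

theorem mem_iff_joinQuad_self (h : IsWeakParallelepiped P Q) (p : Quad X) :
    p ∈ P ↔ joinQuad p p ∈ Q :=
  ⟨h.2.2.2.1 p, fun hp => h.2.1 _ hp 0 false⟩

theorem joinQuad_swap_zero_one (h : IsWeakParallelepiped P Q) {a b c d e f g k : X} :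
    joinQuad (a, b, c, d) (e, f, g, k) ∈ Q ↔ joinQuad (a, b, e, f) (c, d, g, k) ∈ Q := by
  have key : ∀ {a b c d e f g k : X}, joinQuad (a, b, c, d) (e, f, g, k) ∈ Q →
      joinQuad (a, b, e, f) (c, d, g, k) ∈ Q := by
    intro a b c d e f g k hx
    convert h.2.2.1 (Equiv.swap 0 1) (fun _ => false) _ hx using 1
    funext v
    have h2 : Equiv.swap (0 : Fin 3) 1 2 = 2 := by decide
    simp only [joinQuad, cubeSym, Equiv.swap_apply_left, Equiv.swap_apply_right, h2,
      Bool.xor_false]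
    cases v 0 <;> cases v 1 <;> cases v 2 <;> rfl
  exact ⟨key, key⟩

theorem joinQuad_swap_zero_two (h : IsWeakParallelepiped P Q) {a b c d e f g k : X} :
    joinQuad (a, b, c, d) (e, f, g, k) ∈ Q ↔ joinQuad (a, e, c, g) (b, f, d, k) ∈ Q := by
  have key : ∀ {a b c d e f g k : X}, joinQuad (a, b, c, d) (e, f, g, k) ∈ Q →
      joinQuad (a, e, c, g) (b, f, d, k) ∈ Q := by
    intro a b c d e f g k hx
    convert h.2.2.1 (Equiv.swap 0 2) (fun _ => false) _ hx using 1
    funext v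
    have h1 : Equiv.swap (0 : Fin 3) 2 1 = 1 := by decide
    simp only [joinQuad, cubeSym, Equiv.swap_apply_left, Equiv.swap_apply_right, h1,
      Bool.xor_false]
    cases v 0 <;> cases v 1 <;> cases v 2 <;> rfl
  exact ⟨key, key⟩

theorem cubeEquiv_iff (h : IsWeakParallelepiped P Q) {p : Quad X} {c d b x y : X}
    (hx : joinQuad p (c, d, b, x) ∈ Q) :
    CubeEquiv Q x y ↔ joinQuad p (c, d, b, y) ∈ Q := by
  have hcd : joinQuad (c, d, b, x) (c, d, b, x) ∈ Q := h.joinQuad_trans (h.joinQuad_symm hx) hx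
  have hbx : joinQuad (b, x, b, x) (b, x, b, x) ∈ Q := h.2.2.2.1 _ (h.1.1 b x)
  unfold CubeEquiv
  rw [← h.joinQuad_congr_left (h.joinQuad_swap_zero_two.1 hbx), h.joinQuad_swap_zero_two,
    ← h.joinQuad_congr_left (h.joinQuad_swap_zero_one.1 hcd), h.joinQuad_swap_zero_one,
    ← h.joinQuad_congr_left hx]

theorem cubeEquiv_refl (h : IsWeakParallelepiped P Q) (x : X) : CubeEquiv Q x x :=
  h.2.2.2.1 _ (h.1.1 x x)

theorem cubeEquiv_symm (h : IsWeakParallelepiped P Q) {x y : X} (hxy : CubeEquiv Q x y) :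
    CubeEquiv Q y x :=
  (h.cubeEquiv_iff hxy).2 (h.cubeEquiv_refl x)

theorem cubeEquiv_trans (h : IsWeakParallelepiped P Q) {x y z : X} (hxy : CubeEquiv Q x y)
    (hyz : CubeEquiv Q y z) : CubeEquiv Q x z :=
  (h.cubeEquiv_iff hxy).1 hyz

/-- The setoid on `X` given by `CubeEquiv`. -/
def cubeSetoid (h : IsWeakParallelepiped P Q) : Setoid X where
  r := CubeEquiv Q
  iseqv := ⟨h.cubeEquiv_refl, h.cubeEquiv_symm, h.cubeEquiv_trans⟩

theorem update_last_mem (h : IsWeakParallelepiped P Q) {x : Cube X} (hx : x ∈ Q) {y : X}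
    (hy : CubeEquiv Q (x fun _ => true) y) : Function.update x (fun _ => true) y ∈ Q := by
  rw [← joinQuad_face x] at hx
  have hl : insert3 0 true true true = fun _ => true := by decide
  have hne : ∀ u w : Bool, insert3 0 false u w ≠ fun _ => true := by decide
  have h00 : insert3 0 true false false ≠ fun _ => true := by decide
  have h01 : insert3 0 true false true ≠ fun _ => true := by decide
  have h10 : insert3 0 true true false ≠ fun _ => true := by decide
  rw [← joinQuad_face (Function.update x (fun _ => true) y)]
  simp only [face, hl, Function.update_self, Function.update_of_ne (hne _ _),
    Function.update_of_ne h00, Function.update_of_ne h01, Function.update_of_ne h10]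
  simp only [face, hl] at hx
  exact (h.cubeEquiv_iff hx).1 hy

theorem update_mem (h : IsWeakParallelepiped P Q) {x : Cube X} (hx : x ∈ Q) (v : Vtx) {y : X}
    (hy : CubeEquiv Q (x v) y) : Function.update x v y ∈ Q := by
  let c : Vtx := fun j => !v j
  have hinv : ∀ w, cubeSym 1 c (cubeSym 1 c w) = w := by
    intro w
    funext j
    simp [cubeSym]
  have hlast : cubeSym 1 c (fun _ => true) = v := by
    funext j
    simp [cubeSym, c]
  have hv : cubeSym 1 c v = fun _ => true := by rw [← hlast, hinv]
  have hupd := h.2.2.1 1 c _ (h.update_last_mem (h.2.2.1 1 c x hx) (y := y) (by rwa [hlast]))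
  convert hupd using 1
  funext w
  by_cases hw : w = v
  · subst hw
    rw [hv, Function.update_self, Function.update_self]
  · have hw' : cubeSym 1 c w ≠ fun _ => true := fun he => hw (by rw [← hinv w, he, hlast])
    rw [Function.update_of_ne hw, Function.update_of_ne hw', hinv]

theorem mem_of_cubeEquiv (h : IsWeakParallelepiped P Q) {x y : Cube X} (hx : x ∈ Q)
    (hxy : ∀ v, CubeEquiv Q (x v) (y v)) : y ∈ Q := by
  classical
  have key : ∀ S : Finset Vtx, S.piecewise y x ∈ Q := by
    intro S
    induction S using Finset.induction_on with
    | empty => simpa using hx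
    | insert v S hv ih =>
      rw [Finset.piecewise_insert]
      refine h.update_mem ih v ?_
      rw [Finset.piecewise_eq_of_notMem _ _ _ hv]
      exact hxy v
  simpa using key Finset.univ

section Saturation

variable {f : X → X}

theorem mapCube_mem_iff (h : IsWeakParallelepiped P Q) (hf : ∀ x, CubeEquiv Q x (f x))
    (x : Cube X) : mapCube f x ∈ Q ↔ x ∈ Q :=
  ⟨fun hx => h.mem_of_cubeEquiv hx fun v => h.cubeEquiv_symm (hf (x v)),
    fun hx => h.mem_of_cubeEquiv hx fun v => hf (x v)⟩

theorem map4_mem_iff (h : IsWeakParallelepiped P Q) (hf : ∀ x, CubeEquiv Q x (f x))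
    (p : Quad X) : map4 f p ∈ P ↔ p ∈ P := by
  rw [h.mem_iff_joinQuad_self, h.mem_iff_joinQuad_self, ← mapCube_joinQuad, h.mapCube_mem_iff hf]

end Saturation

/-- The pullback along a section `s` of `r` is a weak structure, when `s ∘ r` moves points only
within their classes. -/
theorem preimage_section (h : IsWeakParallelepiped P Q) {r : X → Y} {s : Y → X}
    (hrs : ∀ y, r (s y) = y) (hsr : ∀ x, CubeEquiv Q x (s (r x))) :
    IsWeakParallelepiped (map4 s ⁻¹' P) (mapCube s ⁻¹' Q) := by
  have hs : ∀ y, s (r (s y)) = s y := fun y => by rw [hrs]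
  refine ⟨⟨fun a b => h.1.1 _ _, fun a b c d => h.1.2.1 _ _ _ _,
    fun a b c d e f => h.1.2.2.1 _ _ _ _ _ _, fun a b c d => h.1.2.2.2.1 _ _ _ _, ?_⟩,
    fun x hx i b => h.2.1 _ hx i b, fun σ c x hx => h.2.2.1 σ c _ hx, ?_, ?_, ?_, ?_⟩
  · intro a b c
    obtain ⟨d, hd⟩ := h.1.2.2.2.2 (s a) (s b) (s c)
    refine ⟨r d, ?_⟩
    have hd' := (h.map4_mem_iff hsr _).2 hd
    simpa only [Set.mem_preimage, map4, hs] using hd'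
  · intro p hp
    rw [Set.mem_preimage, mapCube_joinQuad]
    exact h.2.2.2.1 _ hp
  · intro p q hpq
    rw [Set.mem_preimage, mapCube_joinQuad] at hpq ⊢
    exact h.joinQuad_symm hpq
  · intro p q t hpq hqt
    rw [Set.mem_preimage, mapCube_joinQuad] at hpq hqt ⊢
    exact h.joinQuad_trans hpq hqt
  · intro x000 x001 x010 x011 x100 x101 x110 h1 h2 h3
    obtain ⟨x, hx⟩ := h.2.2.2.2.2.2 _ _ _ _ _ _ _ h1 h2 h3
    refine ⟨r x, ?_⟩
    have hx' := (h.mapCube_mem_iff hsr _).2 hx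
    rw [mapCube_joinQuad] at hx'
    rw [Set.mem_preimage, mapCube_joinQuad]
    simpa only [map4, hs] using hx'

end IsWeakParallelepiped

/-- Every weak parallelepiped structure on a nonempty set is the inverse
image, under a surjection applied coordinatewise, of a strong parallelepiped structure. -/
theorem weak_is_preimage_of_strong (X : Type) [Nonempty X]
    (P : Set (Quad X)) (Q : Set (Cube X)) (h : IsWeakParallelepiped P Q) :
    ∃ (Y : Type) (r : X → Y) (PY : Set (Quad Y)) (QY : Set (Cube Y)),
      Function.Surjective r ∧ IsStrongParallelepiped PY QY ∧
      P = map4 r ⁻¹' PY ∧ Q = mapCube r ⁻¹' QY := by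
  let S := h.cubeSetoid
  let r : X → Quotient S := Quotient.mk S
  let s : Quotient S → X := Quotient.out
  have hrs : ∀ y, r (s y) = y := Quotient.out_eq
  have hsr : ∀ x, CubeEquiv Q x (s (r x)) := fun x =>
    h.cubeEquiv_symm (Quotient.exact (hrs (r x)))
  refine ⟨Quotient S, r, map4 s ⁻¹' P, mapCube s ⁻¹' Q, Quotient.mk_surjective,
    ⟨h.preimage_section hrs hsr, ?_⟩, ?_, ?_⟩
  · intro x000 x001 x010 x011 x100 x101 x110 h1 h2 h3
    obtain ⟨y, hy⟩ := (h.preimage_section hrs hsr).2.2.2.2.2.2 _ _ _ _ _ _ _ h1 h2 h3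
    refine ⟨y, hy, fun z hz => ?_⟩
    rw [Set.mem_preimage, mapCube_joinQuad] at hy
    simp only [Set.mem_preimage, mapCube_joinQuad] at hz
    have hzy : CubeEquiv Q (s z) (s y) := (h.cubeEquiv_iff hz).2 hy
    rw [← hrs z, ← hrs y]
    exact Quotient.sound hzy
  · ext p
    exact (h.map4_mem_iff hsr p).symm
  · ext x
    exact (h.mapCube_mem_iff hsr x).symm

end HK
end

section
/- Let (𝒫,𝒬) be a strong parallelepiped structure on a nonempty set X, with base B, fiber group F, and structure group 𝒢. If the abelian group F is injective (equivalently, divisible) or the abelian group B is projective, then 𝒢 acts transitively on X, and consequently (𝒫,𝒬) is isomorphic to a nilparallelepiped structure. -/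
open scoped Pointwise

namespace HK

variable {X Y : Type}

namespace IsWeakParallelogram

variable {P : Set (Quad X)}

/-- Points of `X` up to lying in the fiber of `π`, relative to a base point `o`. -/
def fiberSetoid (hP : IsWeakParallelogram P) (o : X) : Setoid X where
  r x y := (o, x, o, y) ∈ P
  iseqv := ⟨fun x => hP.1 o x, fun h => hP.2.1 _ _ _ _ h, fun h h' => hP.2.2.1 _ _ _ _ _ _ h h'⟩

/-- The class of a point in the base, relative to a base point `o`. -/
def proj (hP : IsWeakParallelogram P) (o x : X) : Quotient (hP.fiberSetoid o) :=
  Quotient.mk _ x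

theorem proj_surjective (hP : IsWeakParallelogram P) (o : X) :
    Function.Surjective (hP.proj o) := Quotient.mk_surjective

theorem proj_eq_iff (hP : IsWeakParallelogram P) {o x y : X} :
    hP.proj o x = hP.proj o y ↔ (o, x, o, y) ∈ P := Quotient.eq (r := hP.fiberSetoid o)

/-- Addition on the base: `x + y = z` when `(o, x, y, z)` is a parallelogram. -/
noncomputable def baseAdd (hP : IsWeakParallelogram P) (o : X)
    (u v : Quotient (hP.fiberSetoid o)) : Quotient (hP.fiberSetoid o) :=
  hP.proj o (hP.2.2.2.2 o u.out v.out).choose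

theorem baseAdd_proj (hP : IsWeakParallelogram P) {o a b d : X} (h : (o, a, b, d) ∈ P) :
    hP.baseAdd o (hP.proj o a) (hP.proj o b) = hP.proj o d := by
  have hs := (hP.2.2.2.2 o (hP.proj o a).out (hP.proj o b).out).choose_spec
  have ha : (o, (hP.proj o a).out, o, a) ∈ P := hP.proj_eq_iff.1 (Quotient.out_eq _)
  have hb : (o, (hP.proj o b).out, o, b) ∈ P := hP.proj_eq_iff.1 (Quotient.out_eq _)
  refine hP.proj_eq_iff.2 ?_
  obtain ⟨-, symm, trans, flip, -⟩ := id hP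
  have h₁ := trans _ _ _ _ _ _ (symm _ _ _ _ hs) (trans _ _ _ _ _ _ ha h)
  have h₂ := trans _ _ _ _ _ _ (flip _ _ _ _ hb) (flip _ _ _ _ h₁)
  exact flip _ _ _ _ h₂

theorem add_eq_iff_mem (hP : IsWeakParallelogram P) (o : X) {a b c d : X} :
    hP.baseAdd o (hP.proj o a) (hP.proj o d) = hP.baseAdd o (hP.proj o b) (hP.proj o c) ↔
      (a, b, c, d) ∈ P := by
  have key : ∀ a b c d, (a, b, c, d) ∈ P → hP.baseAdd o (hP.proj o a) (hP.proj o d) =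
      hP.baseAdd o (hP.proj o b) (hP.proj o c) := by
    intro a b c d h
    obtain ⟨-, symm, trans, flip, ex⟩ := id hP
    obtain ⟨k, hk⟩ := ex o a c
    obtain ⟨m, hm⟩ := ex a b k
    have h₁ : (o, b, c, m) ∈ P :=
      flip _ _ _ _ (trans _ _ _ _ _ _ (flip _ _ _ _ hk) (flip _ _ _ _ hm))
    have h₂ : (o, a, d, m) ∈ P := trans _ _ _ _ _ _ hk
      (flip _ _ _ _ (trans _ _ _ _ _ _ (symm _ _ _ _ h) hm))
    rw [hP.baseAdd_proj h₁, hP.baseAdd_proj h₂]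
  refine ⟨fun h => ?_, key a b c d⟩
  obtain ⟨refl, symm, trans, flip, ex⟩ := id hP
  obtain ⟨d', hd'⟩ := ex a b c
  have h₁ := h.trans (key _ _ _ _ hd').symm
  obtain ⟨m, hm⟩ := ex o a d
  obtain ⟨m', hm'⟩ := ex o a d'
  rw [hP.baseAdd_proj hm, hP.baseAdd_proj hm', hP.proj_eq_iff] at h₁
  have h₂ : (d, d', m, m') ∈ P := flip _ _ _ _ (trans _ _ _ _ _ _ (symm _ _ _ _ hm) hm')
  have h₃ : (c, c, d, d') ∈ P := trans _ _ _ _ _ _ (flip _ _ _ _ (refl c o))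
    (trans _ _ _ _ _ _ (flip _ _ _ _ h₁) (symm _ _ _ _ h₂))
  exact trans _ _ _ _ _ _ hd' (symm _ _ _ _ (flip _ _ _ _ h₃))

/-- The base of a weak parallelogram structure is an abelian group. -/
@[reducible]
noncomputable def baseAddCommGroup (hP : IsWeakParallelogram P) (o : X) :
    AddCommGroup (Quotient (hP.fiberSetoid o)) :=
  letI : Add (Quotient (hP.fiberSetoid o)) := ⟨hP.baseAdd o⟩
  letI : Zero (Quotient (hP.fiberSetoid o)) := ⟨hP.proj o o⟩
  have neg_exists : ∀ u, ∃ v, hP.baseAdd o v u = hP.proj o o := by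
    intro u
    obtain ⟨a, rfl⟩ := hP.proj_surjective o u
    obtain ⟨d, hd⟩ := hP.2.2.2.2 a o o
    exact ⟨hP.proj o d, hP.baseAdd_proj
      (hP.2.1 _ _ _ _ hd)⟩
  letI : Neg (Quotient (hP.fiberSetoid o)) := ⟨fun u => (neg_exists u).choose⟩
  have comm : ∀ u v, hP.baseAdd o u v = hP.baseAdd o v u := by
    intro u v
    obtain ⟨a, rfl⟩ := hP.proj_surjective o u
    obtain ⟨b, rfl⟩ := hP.proj_surjective o v
    obtain ⟨d, hd⟩ := hP.2.2.2.2 o a b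
    rw [hP.baseAdd_proj hd, hP.baseAdd_proj (hP.2.2.2.1 _ _ _ _ hd)]
  have zero_add : ∀ u, hP.baseAdd o (hP.proj o o) u = u := by
    intro u
    obtain ⟨a, rfl⟩ := hP.proj_surjective o u
    exact hP.baseAdd_proj (hP.2.2.2.1 _ _ _ _ (hP.1 o a))
  letI : AddGroup (Quotient (hP.fiberSetoid o)) := AddGroup.ofLeftAxioms
    (by
      intro u v w
      obtain ⟨a, rfl⟩ := hP.proj_surjective o u
      obtain ⟨b, rfl⟩ := hP.proj_surjective o v
      obtain ⟨c, rfl⟩ := hP.proj_surjective o w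
      obtain ⟨d, hd⟩ := hP.2.2.2.2 o a b
      obtain ⟨e, he⟩ := hP.2.2.2.2 o d c
      obtain ⟨f, hf⟩ := hP.2.2.2.2 o b c
      obtain ⟨-, symm, trans, flip, -⟩ := id hP
      have h₁ : (o, a, f, e) ∈ P := trans _ _ _ _ _ _ hd (flip _ _ _ _
        (trans _ _ _ _ _ _ (symm _ _ _ _ (flip _ _ _ _ hf)) (flip _ _ _ _ he)))
      change hP.baseAdd o (hP.baseAdd o _ _) _ = hP.baseAdd o _ (hP.baseAdd o _ _)
      rw [hP.baseAdd_proj hd, hP.baseAdd_proj he, hP.baseAdd_proj hf, hP.baseAdd_proj h₁])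
    zero_add
    (fun u => (neg_exists u).choose_spec)
  { add_comm := comm }

theorem exists_base (hP : IsWeakParallelogram P) (o : X) :
    ∃ (B : Type) (_ : AddCommGroup B) (π : X → B), Function.Surjective π ∧ π o = 0 ∧
      ∀ a b c d, (a, b, c, d) ∈ P ↔ π a + π d = π b + π c :=
  ⟨_, hP.baseAddCommGroup o, hP.proj o, hP.proj_surjective o, rfl,
    fun _ _ _ _ => (hP.add_eq_iff_mem o).symm⟩

end IsWeakParallelogram

/-- Homomorphisms out of the base of a weak parallelogram structure are induced by maps
that are additive on parallelograms. -/
theorem exists_addMonoidHom_of_parallelogram {A E : Type} [AddCommGroup A] [AddCommGroup E]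
    {ρ : X → E} (hρ : Function.Surjective ρ) {o : X} (ho : ρ o = 0) (f : X → A) (hfo : f o = 0)
    (hf : ∀ a b c d, ρ a + ρ d = ρ b + ρ c → f a + f d = f b + f c) :
    ∃ q : E →+ A, ∀ x, q (ρ x) = f x := by
  have hinj : ∀ x y, ρ x = ρ y → f x = f y := fun x y h => by
    have := hf o x o y (by rw [h, add_comm])
    rw [hfo] at this
    simpa using this.symm
  choose s hs using hρ
  refine ⟨AddMonoidHom.mk' (fun e => f (s e)) fun u v => ?_, fun x => hinj _ _ (hs _)⟩
  have := hf o (s u) (s v) (s (u + v)) (by simp [hs, ho])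
  simpa [hfo] using this

/-- A surjective homomorphism of abelian groups whose kernel is divisible splits: its kernel
has a complement. -/
theorem exists_complement_of_divisible {E B : Type} [AddCommGroup E] [AddCommGroup B]
    (q : E →+ B) (hq : Function.Surjective q)
    (hdiv : ∀ e, q e = 0 → ∀ n : ℕ, 0 < n → ∃ e', q e' = 0 ∧ n • e' = e) :
    ∃ K : AddSubgroup E, (∀ β, ∃ e ∈ K, q e = β) ∧ ∀ e ∈ K, q e = 0 → e = 0 := by
  let : DivisibleBy q.ker ℕ := divisibleByOfSMulRightSurj q.ker ℕ <| by
    rintro n hn ⟨e, he⟩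
    obtain ⟨e', he', h⟩ := hdiv e he n (Nat.pos_of_ne_zero hn)
    exact ⟨⟨e', he'⟩, Subtype.ext h⟩
  let : DivisibleBy q.ker ℤ := AddGroup.divisibleByIntOfDivisibleByNat q.ker
  obtain ⟨r, hr⟩ := (Module.Baer.of_divisible q.ker).extension_property_addMonoidHom
    q.ker.subtype Subtype.val_injective (AddMonoidHom.id q.ker)
  have hr' : ∀ e : q.ker, r e = e := fun e => DFunLike.congr_fun hr e
  refine ⟨r.ker, fun β => ?_, fun e he hqe => ?_⟩
  · obtain ⟨e, rfl⟩ := hq β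
    refine ⟨e - r e, ?_, ?_⟩
    · rw [AddMonoidHom.mem_ker, map_sub, hr', sub_self]
    · rw [map_sub, (r e).2, sub_zero]
  · have := hr' ⟨e, hqe⟩
    rw [AddMonoidHom.mem_ker] at he
    simpa [he] using congrArg Subtype.val this.symm

theorem exists_complement_of_projective {E B : Type} [AddCommGroup E] [AddCommGroup B]
    (q : E →+ B) (hq : Function.Surjective q) (hB : Module.Projective ℤ B) :
    ∃ K : AddSubgroup E, (∀ β, ∃ e ∈ K, q e = β) ∧ ∀ e ∈ K, q e = 0 → e = 0 := by
  obtain ⟨φ, hφ⟩ := Module.projective_lifting_property q.toIntLinearMap LinearMap.id hq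
  have hφ' : ∀ β, q (φ β) = β := fun β => DFunLike.congr_fun hφ β
  refine ⟨φ.toAddMonoidHom.range, fun β => ⟨φ β, ⟨β, rfl⟩, hφ' β⟩, ?_⟩
  rintro _ ⟨β, rfl⟩ h
  obtain rfl : β = 0 := (hφ' β).symm.trans h
  exact map_zero φ

/-- A strong parallelepiped structure with its parallelograms described by a map `π` to an
abelian group and its parallelepipeds by an eight-variable relation `C`, whose arguments are
the vertices in lexicographic order. -/
structure IsCubeRel {B : Type} [AddCommGroup B] (π : X → B)
    (C : X → X → X → X → X → X → X → X → Prop) : Prop where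
  surj : Function.Surjective π
  face : ∀ {a b c d e f g h}, C a b c d e f g h → π a + π d = π b + π c
  swap12 : ∀ {a b c d e f g h}, C a b c d e f g h → C a c b d e g f h
  swap01 : ∀ {a b c d e f g h}, C a b c d e f g h → C a b e f c d g h
  flip0 : ∀ {a b c d e f g h}, C a b c d e f g h → C e f g h a b c d
  refl : ∀ {a b c d}, π a + π d = π b + π c → C a b c d a b c d
  trans : ∀ {a b c d e f g h a' b' c' d'}, C a b c d e f g h → C e f g h a' b' c' d' →
    C a b c d a' b' c' d'
  exists_corner : ∀ {a b c d e f g}, π a + π d = π b + π c → π a + π g = π c + π e →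
    π a + π f = π b + π e → ∃ h, C a b c d e f g h
  corner_unique : ∀ {a b c d e f g h h'}, C a b c d e f g h → C a b c d e f g h' → h = h'

namespace IsCubeRel

variable {B : Type} [AddCommGroup B] {π : X → B} {C : X → X → X → X → X → X → X → X → Prop}
  {a b c d e f g h a' b' c' d' e' f' g' h' : X}

section
variable (hC : IsCubeRel π C)
include hC

theorem swap02 (H : C a b c d e f g h) : C a e c g b f d h :=
  hC.swap01 (hC.swap12 (hC.swap01 H))

theorem flip2 (H : C a b c d e f g h) : C b a d c f e h g :=
  hC.swap02 (hC.flip0 (hC.swap02 H))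

theorem flip1 (H : C a b c d e f g h) : C c d a b g h e f :=
  hC.swap01 (hC.flip0 (hC.swap01 H))

theorem face1 (H : C a b c d e f g h) : π a + π f = π b + π e := hC.face (hC.swap01 H)

theorem trans1 (H : C a b c d e f g h) (H' : C c d c' d' g h g' h') : C a b c' d' e f g' h' :=
  hC.swap01 (hC.trans (hC.swap01 H) (hC.swap01 H'))

theorem trans2 (H : C a b c d e f g h) (H' : C b b' d d' f f' h h') : C a b' c d' e f' g h' :=
  hC.swap02 (hC.trans (hC.swap02 H) (hC.swap02 H'))

theorem refl1 (H : π a + π f = π b + π e) : C a b a b e f e f := hC.swap01 (hC.refl H)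

theorem refl2 (H : π a + π g = π c + π e) : C a a c c e e g g :=
  hC.swap02 (hC.refl (by rw [H, add_comm]))

theorem exists_corner110 (h₁ : π a + π d = π b + π c) (h₂ : π b + π h = π d + π f)
    (h₃ : π a + π f = π b + π e) : ∃ g, C a b c d e f g h := by
  obtain ⟨g, H⟩ := hC.exists_corner (a := b) (b := a) (c := d) (d := c) (e := f) (f := e)
    (g := h) (by rw [h₁.symm]) h₂ h₃.symm
  exact ⟨g, hC.flip2 H⟩

theorem corner110_unique (H : C a b c d e f g h) (K : C a b c d e f g' h) : g = g' :=
  hC.corner_unique (hC.flip2 H) (hC.flip2 K)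

/-- The pairs in the parallelogram class of `(a₀, b₀)`, with the parallelepipeds formed from
four such pairs, form a weak parallelogram structure. -/
theorem isWeakParallelogram_pairs (a₀ b₀ : X) :
    IsWeakParallelogram {t : Quad {p : X × X // π p.2 + π a₀ = π p.1 + π b₀} |
      C t.1.1.1 t.1.1.2 t.2.1.1.1 t.2.1.1.2 t.2.2.1.1.1 t.2.2.1.1.2
        t.2.2.2.1.1 t.2.2.2.1.2} := by
  have aux : ∀ p q : {p : X × X // π p.2 + π a₀ = π p.1 + π b₀},
      π p.1.1 + π q.1.2 = π p.1.2 + π q.1.1 := fun p q => by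
    have := p.2; have := q.2; grind
  refine ⟨fun p q => hC.refl (aux p q), fun _ _ _ _ H => hC.flip0 H,
    fun _ _ _ _ _ _ H H' => hC.trans H H', fun _ _ _ _ H => hC.swap01 H, fun p q r => ?_⟩
  obtain ⟨x, hx⟩ := hC.surj (π q.1.1 + π r.1.1 - π p.1.1)
  obtain ⟨y, H⟩ := hC.exists_corner (aux p q)
    (show π p.1.1 + π x = π q.1.1 + π r.1.1 by rw [hx]; abel) (aux p r)
  refine ⟨⟨(x, y), ?_⟩, H⟩
  have h₁ := hC.face1 (hC.flip1 H)
  have := q.2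
  dsimp only at *
  grind

/-- If every extension of `B` in which the kernel is identified with the fiber over `b₀` has
a complement to the kernel, then some element of the structure group maps `a₀` to `b₀`. -/
theorem exists_translation (a₀ b₀ : X)
    (hsplit : ∀ (E : Type) [AddCommGroup E] (q : E →+ B), Function.Surjective q →
      ∀ ν : {z : X // π z = π b₀} → E, (∀ e, q e = 0 ↔ ∃ z, ν z = e) →
      (∀ z z' z'' : {z : X // π z = π b₀}, C b₀ b₀ b₀ z' b₀ z b₀ z'' →
        ν z + ν z' = ν z'') →
      ∃ K : AddSubgroup E, (∀ β, ∃ e ∈ K, q e = β) ∧ ∀ e ∈ K, q e = 0 → e = 0) :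
    ∃ g : Equiv.Perm X, g a₀ = b₀ ∧
      ∀ a b c d, π a + π d = π b + π c → C (g a) (g b) (g c) (g d) a b c d := by
  have hP := hC.isWeakParallelogram_pairs a₀ b₀
  set S := {p : X × X // π p.2 + π a₀ = π p.1 + π b₀}
  let o : S := ⟨(a₀, b₀), add_comm _ _⟩
  obtain ⟨E, _, ρ, hρ, ho, hmem⟩ := hP.exists_base o
  replace hmem : ∀ p q r t : S, C p.1.1 p.1.2 q.1.1 q.1.2 r.1.1 r.1.2 t.1.1 t.1.2 ↔
      ρ p + ρ t = ρ q + ρ r := hmem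
  obtain ⟨q, hq⟩ := exists_addMonoidHom_of_parallelogram hρ ho
    (fun p : S => π p.1.1 - π a₀) (sub_self _) (fun p q r t H => by
      have := hC.face (hC.swap02 ((hmem p q r t).2 H))
      grind)
  have move : ∀ (p : S) x, π p.1.1 = π x → ∃ y : X, ∃ hy : π y + π a₀ = π x + π b₀,
      ρ ⟨(x, y), hy⟩ = ρ p := by
    rintro ⟨⟨u, v⟩, huv⟩ x hx
    dsimp only at hx huv
    obtain ⟨y, H⟩ := hC.exists_corner (a := a₀) (b := b₀) (c := u) (d := v) (e := a₀) (f := b₀)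
      (g := x) (by grind) (by grind) (by grind)
    have h₁ := hC.face1 (hC.flip1 H)
    have hy : π y + π a₀ = π x + π b₀ := by grind
    refine ⟨y, hy, ?_⟩
    have := (hmem o ⟨(u, v), huv⟩ o ⟨(x, y), hy⟩).1 H
    rw [ho] at this
    simpa using this
  have uniq : ∀ x y y' hy hy', ρ ⟨(x, y), hy⟩ = ρ ⟨(x, y'), hy'⟩ → y = y' := by
    intro x y y' hy hy' H
    have h₁ := (hmem ⟨(x, y), hy⟩ ⟨(x, y), hy⟩ ⟨(x, y), hy⟩ ⟨(x, y'), hy'⟩).2 (by rw [H])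
    have h₂ := (hmem ⟨(x, y), hy⟩ ⟨(x, y), hy⟩ ⟨(x, y), hy⟩ ⟨(x, y), hy⟩).2 rfl
    exact hC.corner_unique h₂ h₁
  have uniq' : ∀ x x' y hy hy', ρ ⟨(x, y), hy⟩ = ρ ⟨(x', y), hy'⟩ → x = x' := by
    intro x x' y hy hy' H
    have h₁ := (hmem ⟨(x, y), hy⟩ ⟨(x, y), hy⟩ ⟨(x, y), hy⟩ ⟨(x', y), hy'⟩).2 (by rw [H])
    have h₂ := (hmem ⟨(x, y), hy⟩ ⟨(x, y), hy⟩ ⟨(x, y), hy⟩ ⟨(x, y), hy⟩).2 rfl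
    exact hC.corner110_unique h₂ h₁
  have hqsurj : Function.Surjective q := by
    intro β
    obtain ⟨x, hx⟩ := hC.surj (π a₀ + β)
    obtain ⟨y, hy⟩ := hC.surj (π b₀ + β)
    exact ⟨ρ ⟨(x, y), by grind⟩, by rw [hq, hx]; abel⟩
  obtain ⟨K, hK, hK₀⟩ := hsplit E q hqsurj
    (fun z => ρ ⟨(a₀, z), by rw [z.2, add_comm]⟩)
    (fun e => by
      constructor
      · intro he
        obtain ⟨p, rfl⟩ := hρ e
        rw [hq] at he
        obtain ⟨z, hz, hzp⟩ := move p a₀ (sub_eq_zero.1 he)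
        exact ⟨⟨z, by grind⟩, hzp⟩
      · rintro ⟨z, rfl⟩
        rw [hq]
        exact sub_self _)
    (fun z z' z'' H => by
      have hz := z.2; have hz' := z'.2; have hz'' := z''.2
      have h₁ : C a₀ b₀ a₀ b₀ a₀ b₀ a₀ b₀ := hC.refl (add_comm _ _)
      have h₂ := (hmem o ⟨(a₀, z'), by rw [hz', add_comm]⟩ ⟨(a₀, z), by rw [hz, add_comm]⟩
        ⟨(a₀, z''), by rw [hz'', add_comm]⟩).1 (hC.trans2 h₁ H)
      rw [ho, zero_add] at h₂
      rw [h₂, add_comm])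
  have key : ∀ p p' : S, ρ p ∈ K → ρ p' ∈ K → π p.1.1 = π p'.1.1 → ρ p = ρ p' := by
    intro p p' hp hp' H
    refine sub_eq_zero.1 (hK₀ _ (K.sub_mem hp hp') ?_)
    rw [map_sub, hq, hq, H, sub_self]
  have hex : ∀ x, ∃ y : X, ∃ hy : π y + π a₀ = π x + π b₀, ρ ⟨(x, y), hy⟩ ∈ K := by
    intro x
    obtain ⟨e, he, hqe⟩ := hK (π x - π a₀)
    obtain ⟨p, rfl⟩ := hρ e
    rw [hq] at hqe
    obtain ⟨y, hy, H⟩ := move p x (sub_left_injective hqe)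
    exact ⟨y, hy, H ▸ he⟩
  choose g hg hgK using hex
  have hinj : Function.Injective g := by
    intro x x' H
    have h₁ := hg x'
    have h₂ := hgK x'
    have h₃ := hg x
    rw [← H] at h₁
    simp only [← H] at h₂
    exact uniq' _ _ _ _ _ (key ⟨(x, g x), hg x⟩ ⟨(x', g x), h₁⟩ (hgK x) h₂
      (by dsimp only; grind))
  have hsurj : Function.Surjective g := by
    intro y
    obtain ⟨x₀, hx₀⟩ := hC.surj (π y + π a₀ - π b₀)
    have h₀ := hg x₀
    obtain ⟨x, H⟩ := hC.exists_corner110 (a := a₀) (b := b₀) (c := x₀) (d := g x₀) (e := a₀)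
      (f := b₀) (h := y) (by grind) (by grind) (add_comm _ _)
    have h₁ := hC.face1 (hC.flip1 H)
    have hy : π y + π a₀ = π x + π b₀ := by grind
    have h₂ := (hmem o ⟨(x₀, g x₀), h₀⟩ o ⟨(x, y), hy⟩).1 H
    rw [ho, zero_add, add_zero] at h₂
    exact ⟨x, uniq _ _ _ _ _ (key ⟨(x, g x), hg x⟩ ⟨(x, y), hy⟩ (hgK x)
      (by rw [h₂]; exact hgK x₀) rfl)⟩
  refine ⟨Equiv.ofBijective g ⟨hinj, hsurj⟩, ?_, fun a b c d H => ?_⟩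
  · have h₁ := hK₀ _ (hgK a₀) (by rw [hq]; exact sub_self _)
    exact uniq _ _ _ _ o.2 (h₁.trans ho.symm)
  · have h₁ := hK₀ (ρ ⟨(a, g a), hg a⟩ + ρ ⟨(d, g d), hg d⟩
      - (ρ ⟨(b, g b), hg b⟩ + ρ ⟨(c, g c), hg c⟩))
      (K.sub_mem (K.add_mem (hgK a) (hgK d)) (K.add_mem (hgK b) (hgK c)))
      (by simp only [map_sub, map_add, hq]; grind)
    have h₂ := (hmem ⟨(a, g a), hg a⟩ ⟨(b, g b), hg b⟩ ⟨(c, g c), hg c⟩ ⟨(d, g d), hg d⟩).2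
      (sub_eq_zero.1 h₁)
    exact hC.flip0 (hC.swap01 (hC.swap12 h₂))

theorem fiber_comp {x y z w z' : X} (H : C x y z w x x z z) (H' : C y x w z' y y w w) :
    z' = z := by
  have h₁ := hC.face1 (hC.swap12 H)
  have h₂ := hC.face1 H
  have h₃ : π w = π z := by have := hC.face1 (hC.flip1 H); grind
  have h₄ := hC.trans2 H (hC.trans H'
    (hC.refl2 (by rw [h₃, ← add_right_cancel h₂, add_comm] : π y + π z = π w + π x)))
  exact hC.corner_unique (hC.flip0 h₄) (hC.refl2 (add_comm _ _))

end

/-- The structure group. -/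
def structGroup (hC : IsCubeRel π C) : Subgroup (Equiv.Perm X) where
  carrier := {g | ∀ a b c d, π a + π d = π b + π c → C (g a) (g b) (g c) (g d) a b c d}
  one_mem' _ _ _ _ H := hC.refl H
  mul_mem' hg hh a b c d H :=
    hC.trans (hg _ _ _ _ (hC.face (hh a b c d H))) (hh a b c d H)
  inv_mem' {g} hg a b c d H := by
    have ginv : ∀ x, g (g⁻¹ x) = x := g.apply_symm_apply
    have shift : ∀ a b, π (g a) + π b = π (g b) + π a := fun a b =>
      hC.face1 (hg a b a b (add_comm _ _))
    have := hg (g⁻¹ a) (g⁻¹ b) (g⁻¹ c) (g⁻¹ d) (by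
      have h₁ := shift (g⁻¹ a) (g⁻¹ b)
      have h₂ := shift (g⁻¹ c) (g⁻¹ d)
      simp only [ginv] at h₁ h₂
      grind)
    simp only [ginv] at this
    exact hC.flip0 this

variable (hC : IsCubeRel π C)
include hC

theorem shift {g : Equiv.Perm X} (hg : g ∈ hC.structGroup) (a b : X) :
    π (g a) + π b = π (g b) + π a :=
  hC.face1 (hg a b a b (add_comm _ _))

theorem proj_apply_of_fiber {g : X → X}
    (hg : ∀ a b, C a (g a) b (g b) a a b b) (a : X) : π (g a) = π a := by
  have := hC.face1 (hg a a)
  grind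

omit hC in
/-- The translations by elements of the fiber group. -/
def fiberTranslations (hC : IsCubeRel π C) : Subgroup (Equiv.Perm X) where
  carrier := {g | ∀ a b, C a (g a) b (g b) a a b b}
  one_mem' _ _ := hC.refl2 (add_comm _ _)
  mul_mem' {g h} hg hh a b := by
    have h₁ := hC.proj_apply_of_fiber hh
    exact hC.trans2 (hh a b)
      (hC.trans (hg (h a) (h b)) (hC.refl2 (by rw [h₁, h₁, add_comm])))
  inv_mem' {g} hg a b := by
    have ginv : ∀ x, g (g⁻¹ x) = x := g.apply_symm_apply
    have h₁ := hC.proj_apply_of_fiber hg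
    have h₂ := hg (g⁻¹ a) (g⁻¹ b)
    have h₃ : ∀ x, π (g⁻¹ x) = π x := fun x => by simpa [ginv] using (h₁ (g⁻¹ x)).symm
    simp only [ginv] at h₂
    exact hC.trans (hC.flip2 h₂) (hC.refl2 (by rw [h₃, h₃, add_comm]))

theorem mem_fiberTranslations {g : Equiv.Perm X} :
    g ∈ hC.fiberTranslations ↔ ∀ a b, C a (g a) b (g b) a a b b := Iff.rfl

theorem fiberTranslations_le : hC.fiberTranslations ≤ hC.structGroup := by
  intro g hg a b c d H
  rw [mem_fiberTranslations] at hg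
  have h₁ : C a a b b c c d d := hC.refl2 (by rw [H, add_comm])
  exact hC.flip0 (hC.swap01 (hC.swap12
    (hC.trans (hC.trans (hg a b) h₁) (hC.flip0 (hg c d)))))

theorem fiber_eq_of_apply_eq {f f' : Equiv.Perm X} (hf : f ∈ hC.fiberTranslations)
    (hf' : f' ∈ hC.fiberTranslations) {x : X} (h : f x = f' x) : f = f' := by
  rw [mem_fiberTranslations] at hf hf'
  ext y
  have h₁ := hC.flip0 (hf x y)
  have h₂ := hC.flip0 (hf' x y)
  rw [← h] at h₂
  exact hC.corner_unique h₁ h₂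

theorem fiberTranslations_commute {f g : Equiv.Perm X} (hf : f ∈ hC.fiberTranslations)
    (hg : g ∈ hC.structGroup) : f * g = g * f := by
  rw [mem_fiberTranslations] at hf
  ext x
  have hfx := hC.proj_apply_of_fiber hf x
  have h₁ : C (g x) (g x) (g x) (g (f x)) x x x (f x) := hg _ _ _ _ (by rw [hfx])
  have h₂ : C (g x) (g x) (g x) (f (g x)) x x x (f x) := hC.flip1 (hC.swap01 (hf (g x) x))
  exact hC.corner_unique (hC.flip0 h₂) (hC.flip0 h₁)

theorem exists_fiberTranslation {x y : X} (hxy : π x = π y) :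
    ∃ f ∈ hC.fiberTranslations, f x = y := by
  have ex : ∀ x y, π x = π y → ∀ z, ∃ w, C x y z w x x z z := by
    intro x y hxy z
    obtain ⟨w, hw⟩ := hC.exists_corner (a := x) (b := x) (c := z) (d := z) (e := x) (f := y)
      (g := z) rfl (add_comm _ _) (by rw [hxy])
    exact ⟨w, hC.flip0 hw⟩
  choose f hf using ex x y hxy
  choose f' hf' using ex y x hxy.symm
  refine ⟨⟨f, f', fun z => hC.fiber_comp (hf z) (hf' _), fun z => hC.fiber_comp (hf' z) (hf _)⟩,
    fun a b => hC.trans1 (hC.flip1 (hf a)) (hf b), ?_⟩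
  exact hC.corner_unique (hC.flip0 (hf x)) (hC.refl1 (by rw [hxy] : π x + π y = π x + π x))

theorem commutator_mem_fiberTranslations {g h : Equiv.Perm X} (hg : g ∈ hC.structGroup)
    (hh : h ∈ hC.structGroup) : g * h * g⁻¹ * h⁻¹ ∈ hC.fiberTranslations := by
  rw [mem_fiberTranslations]
  intro y y'
  obtain ⟨x, rfl⟩ : ∃ x, h (g x) = y := ⟨g⁻¹ (h⁻¹ y), by simp⟩
  obtain ⟨x', rfl⟩ : ∃ x, h (g x) = y' := ⟨g⁻¹ (h⁻¹ y'), by simp⟩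
  have hk : ∀ x, (g * h * g⁻¹ * h⁻¹) (h (g x)) = g (h x) := fun x => by simp
  rw [hk, hk]
  have e₁ := hC.shift hh x x'
  have e₂ := hC.shift hg x x'
  have h₁ : C x (g x) x' (g x') (h x) (g (h x)) (h x') (g (h x')) := by
    have := hg x x' (h x) (h x') (by grind)
    exact hC.swap12 (hC.swap01 (hC.flip0 this))
  have h₂ := hh x (g x) x' (g x') (by grind)
  have e₃ := hC.shift hg (h x) (h x')
  have e₄ := hC.shift hh (g x) (g x')
  exact hC.trans (hC.flip0 (hC.swap02 (hC.trans h₂ h₁))) (hC.refl2 (by grind))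

end IsCubeRel

theorem cubeSym_cubeSym_inv (σ : Equiv.Perm (Fin 3)) (c v : Vtx) :
    cubeSym σ c (cubeSym σ⁻¹ (fun j => c (σ⁻¹ j)) v) = v := by
  funext j
  simp [cubeSym]

/-- A strong parallelepiped structure is described by any realization of its base. -/
theorem IsStrongParallelepiped.isCubeRel {P : Set (Quad X)} {Q : Set (Cube X)}
    (h : IsStrongParallelepiped P Q) {B : Type} [AddCommGroup B] {π : X → B}
    (hsurj : Function.Surjective π)
    (hP : ∀ a b c d, (a, b, c, d) ∈ P ↔ π a + π d = π b + π c) :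
    IsCubeRel π fun a b c d e f g h => joinQuad (a, b, c, d) (e, f, g, h) ∈ Q := by
  obtain ⟨⟨-, hface, hsym, hrefl, hflip, htrans, hex⟩, hu⟩ := h
  have face_mem : ∀ {a b c d e f g h}, joinQuad (a, b, c, d) (e, f, g, h) ∈ Q →
      (a, b, c, d) ∈ P := fun H => by
    simpa [face, insert3, joinQuad, quadAt] using hface _ H 0 false
  have h01 : ∀ {a b c d e f g h}, joinQuad (a, b, c, d) (e, f, g, h) ∈ Q →
      joinQuad (a, b, e, f) (c, d, g, h) ∈ Q := fun H => by
    convert hsym (Equiv.swap 0 1) (fun _ => false) _ H using 1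
    funext v
    rcases h₀ : v 0 <;> rcases h₁ : v 1 <;> rcases h₂ : v 2 <;>
      simp [joinQuad, quadAt, cubeSym, h₀, h₁, h₂, Equiv.swap_apply_of_ne_of_ne]
  have h12 : ∀ {a b c d e f g h}, joinQuad (a, b, c, d) (e, f, g, h) ∈ Q →
      joinQuad (a, c, b, d) (e, g, f, h) ∈ Q := fun H => by
    convert hsym (Equiv.swap 1 2) (fun _ => false) _ H using 1
    funext v
    rcases h₀ : v 0 <;> rcases h₁ : v 1 <;> rcases h₂ : v 2 <;>
      simp [joinQuad, quadAt, cubeSym, h₀, h₁, h₂, Equiv.swap_apply_of_ne_of_ne]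
  refine ⟨hsurj, fun H => (hP _ _ _ _).1 (face_mem H), h12, h01, fun H => hflip _ _ H,
    fun H => hrefl _ ((hP _ _ _ _).2 H), fun H H' => htrans _ _ _ H H',
    fun h₁ h₂ h₃ => hex _ _ _ _ _ _ _ ((hP _ _ _ _).2 h₁) ((hP _ _ _ _).2 h₂)
      ((hP _ _ _ _).2 h₃), fun H H' => (hu _ _ _ _ _ _ _ (face_mem H) ?_ ?_).unique H H'⟩
  · exact face_mem (h01 (h12 H))
  · exact face_mem (h01 H)

/-- Apply a map to the entries of a cube lying in `α`. -/
noncomputable def cubeMapOn (α : Set Vtx) (f : X → X) (x : Cube X) : Cube X :=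
  open Classical in fun v => if v ∈ α then f (x v) else x v

section Invariance

variable {P : Set (Quad X)} {Q : Set (Cube X)}

theorem IsWeakParallelepiped.comp_cubeSym_mem_iff (h : IsWeakParallelepiped P Q)
    (σ : Equiv.Perm (Fin 3)) (c : Vtx) {x : Cube X} :
    (fun v => x (cubeSym σ c v)) ∈ Q ↔ x ∈ Q := by
  refine ⟨fun H => ?_, h.2.2.1 σ c x⟩
  simpa only [cubeSym_cubeSym_inv] using h.2.2.1 σ⁻¹ (fun j => c (σ⁻¹ j)) _ H

theorem IsWeakParallelepiped.cubeMapOn_mem (h : IsWeakParallelepiped P Q) {α β : Set Vtx}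
    (σ : Equiv.Perm (Fin 3)) (c : Vtx) (hαβ : ∀ v, cubeSym σ c v ∈ α ↔ v ∈ β) {f : X → X}
    (hβ : ∀ x ∈ Q, cubeMapOn β f x ∈ Q) {x : Cube X} (hx : x ∈ Q) : cubeMapOn α f x ∈ Q := by
  have := hβ _ ((h.comp_cubeSym_mem_iff σ c).2 hx)
  rw [← h.comp_cubeSym_mem_iff σ c]
  convert this using 1
  funext v
  by_cases hv : v ∈ β <;> simp [cubeMapOn, hαβ v, hv]

variable {B : Type} [AddCommGroup B] {π : X → B}

theorem cubeMapOn_face_mem (h : IsWeakParallelepiped P Q)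
    (hC : IsCubeRel π fun a b c d e f g h => joinQuad (a, b, c, d) (e, f, g, h) ∈ Q)
    {g : Equiv.Perm X} (hg : g ∈ hC.structGroup) {α : Set Vtx} (hα : IsFace3 α) {x : Cube X}
    (hx : x ∈ Q) : cubeMapOn α g x ∈ Q := by
  obtain ⟨i, b, rfl⟩ := hα
  refine h.cubeMapOn_mem (β := {v | v 0 = false}) (Equiv.swap 0 i) (fun _ => b) (fun v => ?_)
    (fun x hx => ?_) hx
  · cases b <;> simp [cubeSym]
  · rw [← joinQuad_face x] at hx
    have := hC.trans (hg _ _ _ _ (hC.face hx)) hx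
    convert this using 1
    rw [← joinQuad_face (cubeMapOn _ _ _)]
    simp [face, insert3, cubeMapOn]

theorem cubeMapOn_edge_mem (h : IsWeakParallelepiped P Q)
    (hC : IsCubeRel π fun a b c d e f g h => joinQuad (a, b, c, d) (e, f, g, h) ∈ Q)
    {g : Equiv.Perm X} (hg : g ∈ hC.fiberTranslations) {α : Set Vtx} (hα : IsEdge3 α)
    {x : Cube X} (hx : x ∈ Q) : cubeMapOn α g x ∈ Q := by
  obtain ⟨i, j, b, c, hij, rfl⟩ := hα
  have hσ : ∀ i j : Fin 3, i ≠ j → ∃ σ : Equiv.Perm (Fin 3), σ i = 0 ∧ σ j = 1 := by decide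
  obtain ⟨σ, hi, hj⟩ := hσ i j hij
  refine h.cubeMapOn_mem (β := {v | v 0 = false ∧ v 1 = false}) σ
    (fun k => if k = i then b else c) (fun v => ?_) (fun x hx => ?_) hx
  · cases b <;> cases c <;> simp [cubeSym, hi, hj, hij.symm]
  · rw [← joinQuad_face x] at hx
    have h₁ := hC.trans (hC.swap12 (hC.flip2 (hg (x ![false, false, false])
      (x ![false, false, true])))) (hC.refl1 (hC.face1 hx))
    have := hC.trans1 h₁ hx
    convert this using 1
    rw [← joinQuad_face (cubeMapOn _ _ _)]
    simp [face, insert3, cubeMapOn]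

end Invariance

section NilStructure

variable {G : Type} [Group G] [MulAction G X]

theorem edgeGroup2_preserves {R : X → X → X → X → Prop}
    (h₁ : ∀ (g : G) a b c d, R a b c d → R (g • a) (g • b) c d)
    (h₂ : ∀ (g : G) a b c d, R a b c d → R (g • a) b (g • c) d)
    (h₃ : ∀ (g : G) a b c d, R a b c d → R (g • a) (g • b) (g • c) (g • d))
    {q : Quad G} (hq : q ∈ edgeGroup2 G) {a b c d : X} (H : R a b c d) :
    R (q.1 • a) (q.2.1 • b) (q.2.2.1 • c) (q.2.2.2 • d) := by
  induction hq using Subgroup.closure_induction'' generalizing a b c d with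
  | mem x hx =>
    obtain ⟨g, rfl | rfl | rfl⟩ := hx
    · simpa using h₁ g _ _ _ _ H
    · simpa using h₂ g _ _ _ _ H
    · exact h₃ g _ _ _ _ H
  | inv_mem x hx =>
    obtain ⟨g, rfl | rfl | rfl⟩ := hx
    · simpa using h₁ g⁻¹ _ _ _ _ H
    · simpa using h₂ g⁻¹ _ _ _ _ H
    · exact h₃ g⁻¹ _ _ _ _ H
  | one => simpa using H
  | mul x y _ _ hx hy => simpa only [Prod.fst_mul, Prod.snd_mul, mul_smul] using hx (hy H)

theorem closure_cubeElt_preserves {Q : Set (Cube X)} (S : Set (G × Set Vtx))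
    (hS : ∀ s ∈ S, (s.1⁻¹, s.2) ∈ S) (h : ∀ s ∈ S, ∀ x ∈ Q, cubeMapOn s.2 (s.1 • ·) x ∈ Q)
    {q : Cube G} (hq : q ∈ Subgroup.closure {y | ∃ s ∈ S, y = cubeElt s.2 s.1})
    {x : Cube X} (hx : x ∈ Q) : (fun v => q v • x v) ∈ Q := by
  have key : ∀ (g : G) α (x : Cube X), (fun v => cubeElt α g v • x v) = cubeMapOn α (g • ·) x := by
    intro g α x
    funext v
    by_cases hv : v ∈ α <;> simp [cubeElt, cubeMapOn, hv]
  induction hq using Subgroup.closure_induction'' generalizing x with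
  | mem y hy =>
    obtain ⟨s, hs, rfl⟩ := hy
    rw [key]
    exact h s hs x hx
  | inv_mem y hy =>
    obtain ⟨s, hs, rfl⟩ := hy
    have : (cubeElt s.2 s.1)⁻¹ = cubeElt s.2 s.1⁻¹ := by
      funext v
      by_cases hv : v ∈ s.2 <;> simp [cubeElt, hv]
    rw [this, key]
    exact h _ (hS s hs) x hx
  | one => simpa using hx
  | mul y z _ _ hy hz => simpa only [Pi.mul_apply, mul_smul] using hy (hz hx)

end NilStructure

theorem image_edgeGroup2_eq {P : Set (Quad X)} {B : Type} [AddCommGroup B] {π : X → B}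
    {C : X → X → X → X → X → X → X → X → Prop} (hC : IsCubeRel π C)
    (hP : ∀ a b c d, (a, b, c, d) ∈ P ↔ π a + π d = π b + π c)
    (ht : ∀ x y, ∃ g ∈ hC.structGroup, g x = y) (i : X) :
    P = map4 (fun g : hC.structGroup => g • i) ''
      ((edgeGroup2 hC.structGroup : Set (Quad hC.structGroup)) *
        (quadSub (hC.fiberTranslations.subgroupOf hC.structGroup) :
          Set (Quad hC.structGroup))) := by
  have hcomm : ∀ (g f : hC.structGroup) (_ : f ∈ hC.fiberTranslations.subgroupOf _) (x : X),
      (g * f) • x = f • g • x := by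
    intro g f hf x
    rw [← mul_smul]
    congr 1
    exact Subtype.ext (hC.fiberTranslations_commute (Subgroup.mem_subgroupOf.1 hf) g.2).symm
  have hshift : ∀ (g : hC.structGroup) a b, π (g • a) + π b = π (g • b) + π a :=
    fun g => hC.shift g.2
  have hfib : ∀ f ∈ hC.fiberTranslations.subgroupOf hC.structGroup, ∀ a, π (f • a) = π a :=
    fun f hf a => hC.proj_apply_of_fiber (Subgroup.mem_subgroupOf.1 hf) a
  ext ⟨x₀, x₁, x₂, x₃⟩
  rw [hP]
  constructor
  · intro H
    obtain ⟨g₀, hg₀, rfl⟩ := ht i x₀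
    obtain ⟨g₁, hg₁, rfl⟩ := ht (g₀ i) x₁
    obtain ⟨g₂, hg₂, rfl⟩ := ht (g₀ i) x₂
    obtain ⟨f, hf, rfl⟩ := hC.exists_fiberTranslation (x := g₂ (g₁ (g₀ i))) (y := x₃) (by
      have := hC.shift hg₂ (g₁ (g₀ i)) (g₀ i)
      grind)
    let γ₀ : hC.structGroup := ⟨g₀, hg₀⟩
    let γ₁ : hC.structGroup := ⟨g₁, hg₁⟩
    let γ₂ : hC.structGroup := ⟨g₂, hg₂⟩
    let φ : hC.structGroup := ⟨f, hC.fiberTranslations_le hf⟩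
    have hφ : φ ∈ hC.fiberTranslations.subgroupOf hC.structGroup := hf
    refine ⟨_, Set.mul_mem_mul (a := (γ₀, γ₁ * γ₀, γ₂ * γ₀, γ₂ * (γ₁ * γ₀)))
      (b := (1, 1, 1, φ)) ?_ ⟨one_mem _, one_mem _, one_mem _, hφ⟩, ?_⟩
    · have m : ∀ g : hC.structGroup, ((g, g, 1, 1) : Quad hC.structGroup) ∈ edgeGroup2 _ ∧
          ((g, 1, g, 1) : Quad hC.structGroup) ∈ edgeGroup2 _ ∧
          ((g, g, g, g) : Quad hC.structGroup) ∈ edgeGroup2 _ := fun g =>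
        ⟨Subgroup.subset_closure ⟨g, .inl rfl⟩, Subgroup.subset_closure ⟨g, .inr (.inl rfl)⟩,
          Subgroup.subset_closure ⟨g, .inr (.inr rfl)⟩⟩
      have := mul_mem (mul_mem (m γ₂).2.2 (inv_mem (m γ₂).1))
        (mul_mem (mul_mem (m γ₁).2.2 (inv_mem (m γ₁).2.1)) (m γ₀).2.2)
      simpa using this
    · simp only [map4, Prod.mk_mul_mk, mul_one, hcomm _ _ hφ]
      rfl
  · rintro ⟨_, ⟨q, hq, r, hr, rfl⟩, H⟩
    obtain ⟨r₀, r₁, r₂, r₃⟩ := r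
    obtain ⟨hr₀, hr₁, hr₂, hr₃⟩ := hr
    dsimp only at hr₀ hr₁ hr₂ hr₃
    have := edgeGroup2_preserves (R := fun a b c d => π a + π d = π b + π c)
      (fun g a b c d H => by have := hshift g a b; grind)
      (fun g a b c d H => by have := hshift g a c; grind)
      (fun g a b c d H => by have := hshift g a b; have := hshift g c d; grind) hq
      (a := i) (b := i) (c := i) (d := i) rfl
    simp only [map4, Prod.fst_mul, Prod.snd_mul, Prod.mk.injEq, hcomm _ _ hr₀, hcomm _ _ hr₁,
      hcomm _ _ hr₂, hcomm _ _ hr₃] at H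
    obtain ⟨rfl, rfl, rfl, rfl⟩ := H
    rwa [hfib _ hr₀, hfib _ hr₁, hfib _ hr₂, hfib _ hr₃]

theorem image_faceGroup_eq {P : Set (Quad X)} {Q : Set (Cube X)} (h : IsWeakParallelepiped P Q)
    {B : Type} [AddCommGroup B] {π : X → B}
    (hC : IsCubeRel π fun a b c d e f g h => joinQuad (a, b, c, d) (e, f, g, h) ∈ Q)
    (ht : ∀ x y, ∃ g ∈ hC.structGroup, g x = y) (i : X) :
    Q = mapCube (fun g : hC.structGroup => g • i) ''
      ((faceGroup hC.structGroup : Set (Cube hC.structGroup)) *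
        (edgeGroup3 (hC.fiberTranslations.subgroupOf hC.structGroup) :
          Set (Cube hC.structGroup))) := by
  set F := hC.fiberTranslations.subgroupOf hC.structGroup
  have hcomm : ∀ (g f : hC.structGroup) (_ : f ∈ F) (x : X), (g * f) • x = f • g • x := by
    intro g f hf x
    rw [← mul_smul]
    congr 1
    exact Subtype.ext (hC.fiberTranslations_commute (Subgroup.mem_subgroupOf.1 hf) g.2).symm
  have hedge_mem : ∀ r ∈ edgeGroup3 F, ∀ v, r v ∈ F := by
    intro r hr v
    have : edgeGroup3 F ≤ Subgroup.pi Set.univ fun _ => F := by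
      refine (Subgroup.closure_le _).2 ?_
      rintro _ ⟨u, hu, α, -, rfl⟩ v -
      by_cases hv : v ∈ α <;> simp [cubeElt, hv, hu, one_mem]
    exact this hr v trivial
  have hface : ∀ q ∈ faceGroup hC.structGroup, ∀ x ∈ Q, (fun v => q v • x v) ∈ Q := by
    intro q hq x hx
    refine closure_cubeElt_preserves (S := {s | IsFace3 s.2}) (fun _ hs => hs)
      (fun s hs x hx => cubeMapOn_face_mem h hC s.1.2 hs hx)
      (Subgroup.closure_mono ?_ hq) hx
    rintro _ ⟨g, α, hα, rfl⟩
    exact ⟨(g, α), hα, rfl⟩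
  have hedge : ∀ r ∈ edgeGroup3 F, ∀ x ∈ Q, (fun v => r v • x v) ∈ Q := by
    intro r hr x hx
    refine closure_cubeElt_preserves (S := {s | s.1 ∈ F ∧ IsEdge3 s.2})
      (fun _ hs => ⟨inv_mem hs.1, hs.2⟩)
      (fun s hs x hx => cubeMapOn_edge_mem h hC (Subgroup.mem_subgroupOf.1 hs.1) hs.2 hx)
      (Subgroup.closure_mono ?_ hr) hx
    rintro _ ⟨g, hg, α, hα, rfl⟩
    exact ⟨(g, α), ⟨hg, hα⟩, rfl⟩
  have hconst : (fun _ => i : Cube X) ∈ Q := by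
    rw [← joinQuad_face (fun _ => i)]
    exact hC.refl rfl
  ext x
  constructor
  · intro hx
    have mface : ∀ (g : hC.structGroup) (j : Fin 3) (b : Bool),
        cubeElt {v : Vtx | v j = b} g ∈ faceGroup hC.structGroup := fun g j b =>
      Subgroup.subset_closure ⟨g, _, ⟨j, b, rfl⟩, rfl⟩
    have medge : ∀ u ∈ F, ∀ j k : Fin 3, j ≠ k →
        cubeElt {v : Vtx | v j = true ∧ v k = true} u ∈ edgeGroup3 F := fun u hu j k hjk =>
      Subgroup.subset_closure ⟨u, hu, _, ⟨j, k, true, true, hjk, rfl⟩, rfl⟩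
    obtain ⟨g₀, hg₀, h₀⟩ := ht i (x ![false, false, false])
    obtain ⟨g₁, hg₁, h₁⟩ := ht (x ![false, false, false]) (x ![false, false, true])
    obtain ⟨g₂, hg₂, h₂⟩ := ht (x ![false, false, false]) (x ![false, true, false])
    obtain ⟨g₃, hg₃, h₃⟩ := ht (x ![false, false, false]) (x ![true, false, false])
    let q : Cube hC.structGroup := cubeElt {v | v 0 = true} ⟨g₃, hg₃⟩ *
      (cubeElt {v | v 1 = true} ⟨g₂, hg₂⟩ * (cubeElt {v | v 2 = true} ⟨g₁, hg₁⟩ *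
      (cubeElt {v | v 0 = true} ⟨g₀, hg₀⟩ * cubeElt {v | v 0 = false} ⟨g₀, hg₀⟩)))
    have hq : q ∈ faceGroup _ :=
      mul_mem (mface _ _ _) (mul_mem (mface _ _ _) (mul_mem (mface _ _ _)
        (mul_mem (mface _ _ _) (mface _ _ _))))
    have hy := hface q hq _ hconst
    set y : Cube X := fun v => q v • i with hydef
    have y000 : y ![false, false, false] = x ![false, false, false] := by
      simp [hydef, q, cubeElt, Subgroup.smul_def, h₀]
    have y001 : y ![false, false, true] = x ![false, false, true] := by
      simp [hydef, q, cubeElt, Subgroup.smul_def, h₀, h₁]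
    have y010 : y ![false, true, false] = x ![false, true, false] := by
      simp [hydef, q, cubeElt, Subgroup.smul_def, h₀, h₂]
    have y100 : y ![true, false, false] = x ![true, false, false] := by
      simp [hydef, q, cubeElt, Subgroup.smul_def, h₀, h₃]
    have hx' := hx
    rw [← joinQuad_face x] at hx'
    have hy' := hy
    rw [← joinQuad_face y] at hy'
    have fibers : ∀ (u v w z z' : X), π u + π z = π v + π w → π u + π z' = π v + π w →
        ∃ f ∈ hC.fiberTranslations, f z' = z := fun u v w z z' H H' =>
      hC.exists_fiberTranslation (add_left_cancel (H'.trans H.symm))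
    simp only [face, insert3] at hx' hy'
    obtain ⟨f₀, hf₀, e₀⟩ := fibers _ _ _ _ (y ![false, true, true]) (hC.face hx')
      (by simpa [y000, y001, y010] using hC.face hy')
    obtain ⟨f₁, hf₁, e₁⟩ := fibers _ _ _ _ (y ![true, false, true]) (hC.face1 hx')
      (by simpa [y000, y001, y100] using hC.face1 hy')
    obtain ⟨f₂, hf₂, e₂⟩ := fibers _ _ _ _ (y ![true, true, false])
      (hC.face1 (hC.swap12 hx'))
      (by simpa [y000, y010, y100] using hC.face1 (hC.swap12 hy'))
    have hle := hC.fiberTranslations_le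
    let r : Cube hC.structGroup := cubeElt {v | v 1 = true ∧ v 2 = true} ⟨f₀, hle hf₀⟩ *
      (cubeElt {v | v 0 = true ∧ v 2 = true} ⟨f₁, hle hf₁⟩ *
        cubeElt {v | v 0 = true ∧ v 1 = true} ⟨f₂, hle hf₂⟩)
    have hr : r ∈ edgeGroup3 F := mul_mem (medge _ hf₀ _ _ (by decide))
      (mul_mem (medge _ hf₁ _ _ (by decide)) (medge _ hf₂ _ _ (by decide)))
    refine ⟨q * r, Set.mul_mem_mul hq hr, ?_⟩
    have hz := hedge r hr y hy
    have hqr : mapCube (fun g : hC.structGroup => g • i) (q * r) = fun v => r v • y v := by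
      funext v
      exact hcomm (q v) (r v) (hedge_mem r hr v) i
    rw [hqr]
    set z : Cube X := fun v => r v • y v with hzdef
    have z000 : z ![false, false, false] = x ![false, false, false] := by
      simp [hzdef, r, cubeElt, y000]
    have z001 : z ![false, false, true] = x ![false, false, true] := by
      simp [hzdef, r, cubeElt, y001]
    have z010 : z ![false, true, false] = x ![false, true, false] := by
      simp [hzdef, r, cubeElt, y010]
    have z100 : z ![true, false, false] = x ![true, false, false] := by
      simp [hzdef, r, cubeElt, y100]
    have z011 : z ![false, true, true] = x ![false, true, true] := by
      simpa [hzdef, r, cubeElt, Subgroup.smul_def] using e₀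
    have z101 : z ![true, false, true] = x ![true, false, true] := by
      simpa [hzdef, r, cubeElt, Subgroup.smul_def] using e₁
    have z110 : z ![true, true, false] = x ![true, true, false] := by
      simpa [hzdef, r, cubeElt, Subgroup.smul_def] using e₂
    have hz' := hz
    rw [← joinQuad_face z] at hz'
    simp only [face, insert3] at hz'
    have z111 : z ![true, true, true] = x ![true, true, true] := by
      refine hC.corner_unique ?_ hx'
      simpa [z000, z001, z010, z100, z011, z101, z110] using hz'
    rw [← joinQuad_face z, ← joinQuad_face x]
    simp [face, insert3, z000, z001, z010, z100, z011, z101, z110, z111]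
  · rintro ⟨_, ⟨q, hq, r, hr, rfl⟩, rfl⟩
    have hqr : mapCube (fun g : hC.structGroup => g • i) (q * r) =
        fun v => r v • q v • i := by
      funext v
      exact hcomm (q v) (r v) (hedge_mem r hr v) i
    rw [hqr]
    exact hedge r hr _ (hface q hq _ hconst)

theorem isNilStructure_of_transitive {P : Set (Quad X)} {Q : Set (Cube X)}
    (h : IsWeakParallelepiped P Q) {B : Type} [AddCommGroup B] {π : X → B}
    (hP : ∀ a b c d, (a, b, c, d) ∈ P ↔ π a + π d = π b + π c)
    (hC : IsCubeRel π fun a b c d e f g h => joinQuad (a, b, c, d) (e, f, g, h) ∈ Q)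
    (ht : ∀ x y, ∃ g ∈ hC.structGroup, g x = y) (i : X) : IsNilStructure P Q := by
  refine ⟨hC.structGroup, inferInstance, hC.fiberTranslations.subgroupOf hC.structGroup,
    MulAction.stabilizer hC.structGroup i, fun g => g • i, ?_, ?_, ?_, ?_, ?_,
    image_edgeGroup2_eq hC hP ht i, image_faceGroup_eq h hC ht i⟩
  · exact Subgroup.commutator_le.2 fun g _ g' _ =>
      hC.commutator_mem_fiberTranslations g.2 g'.2
  · exact fun f hf => Subgroup.mem_center_iff.2 fun g =>
      Subtype.ext (hC.fiberTranslations_commute (Subgroup.mem_subgroupOf.1 hf) g.2).symm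
  · rw [eq_bot_iff]
    rintro f ⟨hf, hf'⟩
    exact Subtype.ext (hC.fiber_eq_of_apply_eq (Subgroup.mem_subgroupOf.1 hf') (one_mem _)
      (x := i) hf)
  · intro y
    obtain ⟨g, hg, rfl⟩ := ht i y
    exact ⟨⟨g, hg⟩, rfl⟩
  · intro g g'
    rw [MulAction.mem_stabilizer_iff, mul_smul, inv_smul_eq_iff, eq_comm]

/-- If the fiber group is divisible, then so is the kernel of every extension of the base in
which the kernel is identified with the fiber over `b₀`. -/
theorem ker_divisible_of_isDivisibleGroup {P : Set (Quad X)} {Q : Set (Cube X)}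
    {B : Type} [AddCommGroup B] {π : X → B}
    (hP : ∀ a b c d, (a, b, c, d) ∈ P ↔ π a + π d = π b + π c)
    (hC : IsCubeRel π fun a b c d e f g h => joinQuad (a, b, c, d) (e, f, g, h) ∈ Q)
    {i : X} {F : Type} [AddCommGroup F] {fl : Quad X → F} (hfl : IsFiberRealization P Q i F fl)
    (hF : IsDivisibleGroup F) (b₀ : X) {E : Type} [AddCommGroup E] (q : E →+ B)
    (ν : {z : X // π z = π b₀} → E) (hν : ∀ e, q e = 0 ↔ ∃ z, ν z = e)
    (hadd : ∀ z z' z'' : {z : X // π z = π b₀},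
      joinQuad (b₀, b₀, b₀, (z' : X)) (b₀, (z : X), b₀, (z'' : X)) ∈ Q → ν z + ν z' = ν z'') :
    ∀ e, q e = 0 → ∀ n : ℕ, 0 < n → ∃ e', q e' = 0 ∧ n • e' = e := by
  obtain ⟨hsurj, hiff, hcomp⟩ := hfl
  have hfib : ∀ x y, sameFiber P i x y ↔ π x = π y := fun x y => by
    rw [sameFiber, hP, add_comm, add_left_inj, eq_comm]
  have hvert : ∀ z : {z : X // π z = π b₀}, VerticalQ P i (b₀, b₀, b₀, (z : X)) := fun z =>
    ⟨(hfib _ _).2 rfl, (hfib _ _).2 rfl, (hfib _ _).2 z.2.symm⟩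
  have hex : ∀ u : F, ∃ z : {z : X // π z = π b₀}, fl (b₀, b₀, b₀, (z : X)) = u := by
    intro u
    obtain ⟨⟨w₀, w₁, w₂, w₃⟩, hw, rfl⟩ := hsurj u
    obtain ⟨h₁, h₂, h₃⟩ := hw
    have g₁ := (hfib _ _).1 h₁
    have g₂ := (hfib _ _).1 h₂
    have g₃ := (hfib _ _).1 h₃
    dsimp only at g₁ g₂ g₃
    obtain ⟨z, H⟩ := hC.exists_corner (a := w₀) (b := w₁) (c := w₂) (d := w₃) (e := b₀)
      (f := b₀) (g := b₀) (by grind) (by grind) (by grind)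
    have hz := hC.face (hC.flip0 H)
    let z' : {z : X // π z = π b₀} := ⟨z, add_left_cancel hz⟩
    exact ⟨z', ((hiff _ _ ⟨h₁, h₂, h₃⟩ (hvert z')).2 H).symm⟩
  have hinj : ∀ z z' : {z : X // π z = π b₀},
      fl (b₀, b₀, b₀, (z : X)) = fl (b₀, b₀, b₀, (z' : X)) → z = z' := fun z z' H =>
    Subtype.ext (hC.corner_unique
      (hC.refl (by rw [z.2] : π b₀ + π (z : X) = π b₀ + π b₀))
      ((hiff _ _ (hvert z) (hvert z')).1 H))
  choose ζ hζ using hex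
  let j : F →+ E := AddMonoidHom.mk' (fun u => ν (ζ u)) fun u u' => by
    have hz := (ζ u).2
    have hz' := (ζ u').2
    obtain ⟨y, H⟩ := hC.exists_corner (a := b₀) (b := b₀) (c := b₀) (d := ζ u') (e := b₀)
      (f := ζ u) (g := b₀) (by rw [hz']) rfl (by rw [hz])
    have hy : π y = π b₀ := by have := hC.face (hC.flip0 H); grind
    rw [hadd (ζ u) (ζ u') ⟨y, hy⟩ H]
    congr 1
    refine hinj _ _ ?_
    rw [hζ]
    have h₁ := hcomp b₀ b₀ b₀ (ζ u) b₀ y ((hfib _ _).2 rfl) ((hfib _ _).2 rfl)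
      ((hfib _ _).2 hz.symm) ((hfib _ _).2 hz) ((hfib _ _).2 hy.symm)
    have h₂ := (hiff _ _ (hvert (ζ u'))
      ⟨(hfib _ _).2 hz.symm, (hfib _ _).2 hz, (hfib _ _).2 hy.symm⟩).2 H
    rw [← h₁, ← h₂, hζ, hζ]
  intro e he n hn
  obtain ⟨z, rfl⟩ := (hν e).1 he
  obtain ⟨v, hv⟩ := hF (fl (b₀, b₀, b₀, (z : X))) n hn
  refine ⟨j v, (hν _).2 ⟨_, rfl⟩, ?_⟩
  rw [← map_nsmul, hv]
  exact congrArg ν (hinj _ _ (hζ _))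

theorem exists_proj_of_isBaseRealization {P : Set (Quad X)} (hP : IsWeakParallelogram P)
    {B : Type} [AddCommGroup B] {c : X → X → B} (hc : IsBaseRealization P B c) (i : X) :
    Function.Surjective (c i) ∧
      ∀ x y z w, (x, y, z, w) ∈ P ↔ c i x + c i w = c i y + c i z := by
  obtain ⟨hsurj, hiff, hadd⟩ := hc
  refine ⟨fun β => ?_, fun x y z w => ?_⟩
  · obtain ⟨⟨x, y⟩, rfl⟩ := hsurj β
    obtain ⟨w, hw⟩ := hP.2.2.2.2 x y i
    exact ⟨w, ((hiff _ _ _ _).2 hw).symm⟩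
  · rw [← hiff, ← hadd i x y, ← hadd i z w]
    constructor <;> intro H <;> grind


/-- If the fiber group `F` of a strong parallelepiped structure is
injective (equivalently, divisible), or if the base group `B` is projective, then the
structure group acts transitively on `X`, and consequently `(P, Q)` is (isomorphic to)
a nilparallelepiped structure. -/
theorem nilstructure_of_injective_or_projective (X : Type) [Nonempty X]
    (P : Set (Quad X)) (Q : Set (Cube X)) (h : IsStrongParallelepiped P Q) (i : X)
    (hyp : (∃ (F : Type) (instF : AddCommGroup F) (fl : Quad X → F),
        @IsFiberRealization X P Q i F instF fl ∧ @IsDivisibleGroup F instF) ∨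
      (∃ (B : Type) (instB : AddCommGroup B) (c : X → X → B),
        @IsBaseRealization X P B instB c ∧ @IsProjectiveAdd B instB)) :
    (∀ x y : X, ∃ g ∈ structSet P Q, g x = y) ∧ IsNilStructure P Q := by
  have main : ∀ (B : Type) [AddCommGroup B] (π : X → B), Function.Surjective π →
      (∀ a b c d, (a, b, c, d) ∈ P ↔ π a + π d = π b + π c) →
      ∀ (hC : IsCubeRel π fun a b c d e f g h => joinQuad (a, b, c, d) (e, f, g, h) ∈ Q),
      (∀ x y, ∃ g ∈ hC.structGroup, g x = y) →
      (∀ x y : X, ∃ g ∈ structSet P Q, g x = y) ∧ IsNilStructure P Q := by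
    intro B _ π _ hP hC ht
    refine ⟨fun x y => ?_, isNilStructure_of_transitive h.1 hP hC ht i⟩
    obtain ⟨g, hg, hxy⟩ := ht x y
    refine ⟨g, fun p hp => ?_, hxy⟩
    have hgp := hg _ _ _ _ ((hP _ _ _ _).1 hp)
    exact ⟨(hP _ _ _ _).2 (hC.face hgp), hgp⟩
  rcases hyp with ⟨F, _, fl, hfl, hF⟩ | ⟨B, _, c, hc, hB⟩
  · obtain ⟨B, _, π, hsurj, -, hP⟩ := h.1.1.exists_base i
    have hC := h.isCubeRel hsurj hP
    refine main B π hsurj hP hC fun x y => ?_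
    obtain ⟨g, hxy, hg⟩ := hC.exists_translation x y fun E _ q hq ν hν hadd =>
      exists_complement_of_divisible q hq
        (ker_divisible_of_isDivisibleGroup hP hC hfl hF y q ν hν hadd)
    exact ⟨g, hg, hxy⟩
  · obtain ⟨hsurj, hP⟩ := exists_proj_of_isBaseRealization h.1.1 hc i
    have hC := h.isCubeRel hsurj hP
    refine main B (c i) hsurj hP hC fun x y => ?_
    obtain ⟨g, hxy, hg⟩ := hC.exists_translation x y fun E _ q hq _ _ _ =>
      exists_complement_of_projective q hq hB
    exact ⟨g, hg, hxy⟩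

end HK
end
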